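/- Let a, b, c, d, e be real with a > 0, b > 0, c > 0, e > a, d + e − a − b − c > 0, and min(d, e) > max(b, c). Then ∫_0^1 t^{b−1}(1−t)^{d+e−a−b−c−1} ₂F₁(e−c, d−c; d+e−b−c; 1−t) dt = [Γ(b)Γ(c)Γ(d+e−a−b−c)/(Γ(a)Γ(d−a)Γ(e−a))] ∫_0^1 t^{e−a−1}(1−t)^{a−1} ₂F₁(e−c, e−b; d+e−b−c; 1−t) dt. -/

import Mathlib

open MeasureTheory Real

/-- Pochhammer symbol `(a)_n = a(a+1)⋯(a+n−1)`. -/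
noncomputable def poch (a : ℝ) (n : ℕ) : ℝ := (ascPochhammer ℝ n).eval a

/-- Gauss hypergeometric series `₂F₁(α, β; γ; y)`. -/
noncomputable def F21 (α β γ y : ℝ) : ℝ :=
  ∑' n : ℕ, poch α n * poch β n / (poch γ n * (n.factorial : ℝ)) * y ^ n

lemma poch_pos' {a : ℝ} (ha : 0 < a) (n : ℕ) : 0 < poch a n := ascPochhammer_pos n a ha

lemma poch_succ' (a : ℝ) (n : ℕ) : poch a (n + 1) = poch a n * (a + n) := by
  simp [poch, ascPochhammer_succ_eval]

lemma Gamma_add_nat' {a : ℝ} (ha : 0 < a) (n : ℕ) :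
    Gamma (a + n) = poch a n * Gamma a := by
  induction n with
  | zero => simp [poch]
  | succ n ih =>
    have h : a + n ≠ 0 := by positivity
    rw [poch_succ', Nat.cast_succ, ← add_assoc, Real.Gamma_add_one h, ih]; ring

lemma poch_mono' {a b : ℝ} (ha : 0 < a) (hab : a ≤ b) (n : ℕ) : poch a n ≤ poch b n := by
  induction n with
  | zero => simp [poch]
  | succ n ih =>
    rw [poch_succ', poch_succ']
    have := poch_pos' ha n
    have := poch_pos' (ha.trans_le hab) n
    gcongr

lemma choose_eq_poch (a : ℝ) (n : ℕ) :
    Ring.choose (a + n - 1) n = poch a n / n.factorial := by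
  rw [← Ring.multichoose_eq]
  have h := Ring.factorial_nsmul_multichoose_eq_ascPochhammer a n
  rw [Polynomial.ascPochhammer_smeval_eq_eval, nsmul_eq_mul] at h
  rw [poch, ← h]
  field_simp

lemma binom_hasSum (z : ℝ) {w : ℝ} (h0 : 0 ≤ w) (h1 : w < 1) :
    HasSum (fun n : ℕ => poch z n / n.factorial * w ^ n) ((1 - w) ^ (-z)) := by
  have h := (Real.one_div_one_sub_rpow_hasFPowerSeriesOnBall_zero z).hasSum (y := w) (by
    simp [abs_of_nonneg h0, ← ofReal_norm, h1])
  simp only [zero_add, FormalMultilinearSeries.ofScalars_apply_eq, choose_eq_poch,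
    smul_eq_mul] at h
  rw [Real.rpow_neg (by linarith), ← one_div]
  exact h

lemma coef_nonneg {x y u : ℝ} (hx : 0 < x) (hy : 0 < y) (hu : 0 < u) (n : ℕ) :
    0 ≤ poch x n * poch y n / (poch u n * (n.factorial : ℝ)) := by
  have := poch_pos' hx n
  have := poch_pos' hy n
  have := poch_pos' hu n
  positivity

lemma F21_hasSum {x y u w : ℝ} (hx : 0 < x) (hy : 0 < y) (hyu : y ≤ u) (h0 : 0 ≤ w)
    (h1 : w < 1) :
    HasSum (fun n : ℕ => poch x n * poch y n / (poch u n * (n.factorial : ℝ)) * w ^ n)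
      (F21 x y u w) := by
  have hu : 0 < u := by linarith
  refine Summable.hasSum (Summable.of_nonneg_of_le (fun n => ?_) (fun n => ?_)
    (binom_hasSum x h0 h1).summable)
  · have := coef_nonneg hx hy hu n
    positivity
  · have h2 := poch_pos' hx n
    have h3 := poch_pos' hy n
    have h4 := poch_pos' hu n
    have h5 := poch_mono' hy hyu n
    have : poch x n * poch y n / (poch u n * (n.factorial : ℝ))
        = poch x n / n.factorial * (poch y n / poch u n) := by field_simp
    rw [this]
    have h6 : poch y n / poch u n ≤ 1 := (div_le_one h4).2 h5
    have : poch x n / n.factorial * (poch y n / poch u n) ≤ poch x n / n.factorial :=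
      mul_le_of_le_one_right (by positivity) h6
    gcongr

lemma F21_nonneg {x y u w : ℝ} (hx : 0 < x) (hy : 0 < y) (hyu : y ≤ u) (h0 : 0 ≤ w) :
    0 ≤ F21 x y u w := by
  refine tsum_nonneg fun n => ?_
  have := coef_nonneg hx hy (hy.trans_le hyu) n
  positivity

lemma lint_beta {p q : ℝ} (hp : 0 < p) (hq : 0 < q) :
    ∫⁻ t in Set.Ioo (0 : ℝ) 1, ENNReal.ofReal (t ^ (p - 1) * (1 - t) ^ (q - 1)) =
      ENNReal.ofReal (Gamma p * Gamma q / Gamma (p + q)) := by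
  have h := ProbabilityTheory.lintegral_betaPDF_eq_one hp hq
  rw [ProbabilityTheory.lintegral_betaPDF] at h
  have hB := ProbabilityTheory.beta_pos hp hq
  change _ = ENNReal.ofReal (ProbabilityTheory.beta p q)
  have : ∀ t : ℝ, ENNReal.ofReal (1 / ProbabilityTheory.beta p q * t ^ (p - 1) * (1 - t) ^ (q - 1))
      = ENNReal.ofReal (1 / ProbabilityTheory.beta p q) *
        ENNReal.ofReal (t ^ (p - 1) * (1 - t) ^ (q - 1)) := by
    intro t
    rw [← ENNReal.ofReal_mul (by positivity), mul_assoc]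
  simp_rw [this] at h
  rw [lintegral_const_mul _ (by fun_prop)] at h
  calc _ = ENNReal.ofReal (ProbabilityTheory.beta p q) *
        (ENNReal.ofReal (1 / ProbabilityTheory.beta p q) * _) := by
        rw [← mul_assoc, ← ENNReal.ofReal_mul hB.le, mul_one_div_cancel hB.ne', ENNReal.ofReal_one,
          one_mul]
    _ = _ := by rw [h, mul_one]

lemma lint_series {p q : ℝ} (hp : 0 < p) (hq : 0 < q) (c : ℕ → ℝ) (hc : ∀ n, 0 ≤ c n)
    (f : ℝ → ℝ) (hf : ∀ t ∈ Set.Ioo (0 : ℝ) 1, HasSum (fun n => c n * (1 - t) ^ n) (f t)) :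
    ∫⁻ t in Set.Ioo (0 : ℝ) 1, ENNReal.ofReal (t ^ (p - 1) * (1 - t) ^ (q - 1) * f t) =
      ∑' n, ENNReal.ofReal (c n * (Gamma p * (poch q n * Gamma q) / Gamma (p + q + n))) := by
  have h1 : ∫⁻ t in Set.Ioo (0 : ℝ) 1, ENNReal.ofReal (t ^ (p - 1) * (1 - t) ^ (q - 1) * f t) =
      ∫⁻ t in Set.Ioo (0 : ℝ) 1, ∑' n, ENNReal.ofReal (c n) *
        ENNReal.ofReal (t ^ (p - 1) * (1 - t) ^ (q + n - 1)) := by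
    refine setLIntegral_congr_fun measurableSet_Ioo fun t ht => ?_
    have ht0 : 0 < t := ht.1
    have ht1 : 0 < 1 - t := by linarith [ht.2]
    have hs := (hf t ht).mul_left (t ^ (p - 1) * (1 - t) ^ (q - 1))
    rw [← hs.tsum_eq, ENNReal.ofReal_tsum_of_nonneg _ hs.summable]
    · congr 1; ext n
      rw [← ENNReal.ofReal_mul (hc n), show q + n - 1 = (q - 1) + n by ring,
        Real.rpow_add_natCast ht1.ne']
      congr 1; ring
    · intro n
      have := hc n
      positivity
  rw [h1, lintegral_tsum (fun n => by fun_prop)]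
  congr 1; ext n
  have hqn : 0 < q + n := by positivity
  rw [lintegral_const_mul _ (by fun_prop), lint_beta hp hqn, ← ENNReal.ofReal_mul (hc n),
    Gamma_add_nat' hq, add_assoc]

lemma euler_int {k y z w : ℝ} (hk : 0 < k) (hy : 0 < y) (hz : 0 < z) (hzu : z ≤ y + k)
    (h0 : 0 < w) (h1 : w < 1) :
    ∫⁻ q in Set.Ioo (0 : ℝ) 1,
      ENNReal.ofReal (q ^ (k - 1) * (1 - q) ^ (y - 1) * (1 - w * (1 - q)) ^ (-z)) =
      ENNReal.ofReal (Gamma k * Gamma y / Gamma (y + k) * F21 y z (y + k) w) := by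
  have hu : 0 < y + k := by positivity
  have hGk := Gamma_pos_of_pos hk
  have hGy := Gamma_pos_of_pos hy
  have hGu := Gamma_pos_of_pos hu
  rw [lint_series hk hy (fun n => poch z n / n.factorial * w ^ n)
    (fun n => by have := poch_pos' hz n; positivity)]
  · have hs := (F21_hasSum (w := w) hy hz hzu h0.le h1).mul_left
      (Gamma k * Gamma y / Gamma (y + k))
    rw [← hs.tsum_eq, ENNReal.ofReal_tsum_of_nonneg _ hs.summable]
    · congr 1; ext n
      have := poch_pos' hu n
      rw [add_comm k y, Gamma_add_nat' hu]
      congr 1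
      field_simp
    · intro n
      have := coef_nonneg hy hz hu n
      positivity
  · intro t ht
    have h2 : 0 < 1 - t := by linarith [ht.2]
    have h3 : 1 - t < 1 := by linarith [ht.1]
    have := binom_hasSum z (w := w * (1 - t)) (by positivity) (by nlinarith)
    refine this.congr_fun fun n => ?_
    rw [mul_pow]; ring

lemma image_eq {w : ℝ} (h0 : 0 < w) (h1 : w < 1) :
    (fun r : ℝ => (1 - w) * (1 - r) / (1 - w + w * r)) '' Set.Ioo 0 1 = Set.Ioo 0 1 := by
  have key : ∀ r ∈ Set.Ioo (0:ℝ) 1, (1 - w) * (1 - r) / (1 - w + w * r) ∈ Set.Ioo (0:ℝ) 1 := by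
    rintro r ⟨hr0, hr1⟩
    have hw : 0 < 1 - w := by linarith
    have hr : 0 < 1 - r := by linarith
    have hD : 0 < 1 - w + w * r := by positivity
    refine ⟨by positivity, ?_⟩
    rw [div_lt_one hD]; nlinarith
  ext q
  constructor
  · rintro ⟨r, hr, rfl⟩; exact key r hr
  · intro hq
    refine ⟨_, key q hq, ?_⟩
    obtain ⟨hq0, hq1⟩ := hq
    have hw : 0 < 1 - w := by linarith
    have hD : 0 < 1 - w + w * q := by positivity
    have e1 : 1 - (1 - w) * (1 - q) / (1 - w + w * q) = q / (1 - w + w * q) := by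
      field_simp; ring
    have e2 : 1 - w + w * ((1 - w) * (1 - q) / (1 - w + w * q)) = (1 - w) / (1 - w + w * q) := by
      field_simp; ring
    simp only
    rw [e1, e2]; field_simp

lemma euler_cov {k y z w : ℝ} (h0 : 0 < w) (h1 : w < 1) :
    ∫⁻ q in Set.Ioo (0 : ℝ) 1,
      ENNReal.ofReal (q ^ (k - 1) * (1 - q) ^ (y - 1) * (1 - w * (1 - q)) ^ (-z)) =
    ENNReal.ofReal ((1 - w) ^ (k - z)) * ∫⁻ r in Set.Ioo (0 : ℝ) 1,
      ENNReal.ofReal (r ^ (y - 1) * (1 - r) ^ (k - 1) * (1 - w * (1 - r)) ^ (-(y + k - z))) := by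
  have hw : 0 < 1 - w := by linarith
  have hder : ∀ r ∈ Set.Ioo (0:ℝ) 1, HasDerivWithinAt
      (fun r : ℝ => (1 - w) * (1 - r) / (1 - w + w * r)) (-(1 - w) / (1 - w + w * r) ^ 2)
      (Set.Ioo 0 1) r := by
    rintro r ⟨hr0, hr1⟩
    have hD : 0 < 1 - w + w * r := by positivity
    have a1 : HasDerivAt (fun r : ℝ => (1 - w) * (1 - r)) ((1 - w) * (-1)) r :=
      ((hasDerivAt_id r).const_sub 1).const_mul (1 - w)
    have a2 : HasDerivAt (fun r : ℝ => 1 - w + w * r) (w * 1) r :=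
      ((hasDerivAt_id r).const_mul w).const_add (1 - w)
    have := (a1.fun_div a2 hD.ne').hasDerivWithinAt (s := Set.Ioo 0 1)
    have e : -(1 - w) / (1 - w + w * r) ^ 2 = ((1 - w) * (-1) * (1 - w + w * r) -
        (1 - w) * (1 - r) * (w * 1)) / (1 - w + w * r) ^ 2 := by
      congr 1; ring
    rw [e]; exact this
  have hinj : Set.InjOn (fun r : ℝ => (1 - w) * (1 - r) / (1 - w + w * r)) (Set.Ioo 0 1) := by
    rintro r ⟨hr0, hr1⟩ s ⟨hs0, hs1⟩ h
    have hD : 0 < 1 - w + w * r := by positivity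
    have hD' : 0 < 1 - w + w * s := by positivity
    simp only at h
    rw [div_eq_div_iff hD.ne' hD'.ne'] at h
    have : (1 - w) * (r - s) = 0 := by
      apply mul_left_cancel₀ (a := (1:ℝ)) one_ne_zero
      have h3 : (1 - w) * ((1 - r) * (1 - w + w * s) - (1 - s) * (1 - w + w * r)) = 0 := by
        linarith
      linear_combination -h3
    rcases mul_eq_zero.1 this with h | h <;> linarith
  have H := lintegral_image_eq_lintegral_abs_deriv_mul measurableSet_Ioo hder hinj
    (fun q => ENNReal.ofReal (q ^ (k - 1) * (1 - q) ^ (y - 1) * (1 - w * (1 - q)) ^ (-z)))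
  rw [image_eq h0 h1] at H
  rw [H, ← lintegral_const_mul _ (by fun_prop)]
  refine setLIntegral_congr_fun measurableSet_Ioo fun r hr => ?_
  obtain ⟨hr0, hr1⟩ := hr
  have hr : 0 < 1 - r := by linarith
  have hD : 0 < 1 - w + w * r := by positivity
  rw [← ENNReal.ofReal_mul (abs_nonneg _), ← ENNReal.ofReal_mul (by positivity)]
  congr 1
  have e1 : 1 - (1 - w) * (1 - r) / (1 - w + w * r) = r / (1 - w + w * r) := by
    field_simp; ring
  rw [e1]
  have e2 : 1 - w * (r / (1 - w + w * r)) = (1 - w) / (1 - w + w * r) := by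
    field_simp; ring
  rw [e2, show 1 - w * (1 - r) = 1 - w + w * r by ring, abs_div, abs_neg, abs_of_pos hw,
    abs_of_pos (by positivity : 0 < (1 - w + w * r) ^ 2)]
  generalize 1 - w + w * r = D at hD
  generalize 1 - w = v at hw
  generalize 1 - r = s at hr
  rw [div_rpow (by positivity) hD.le, div_rpow hr0.le hD.le, div_rpow hw.le hD.le,
    mul_rpow hw.le hr.le]
  have f1 : v ^ (k - z) = v * v ^ (k - 1) * v ^ (-z) := by
    nth_rewrite 2 [← rpow_one v]
    rw [← rpow_add hw, ← rpow_add hw]; congr 1; ring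
  have f2 : D ^ (-(y + k - z)) = (D ^ 2)⁻¹ * (D ^ (k - 1))⁻¹ * (D ^ (y - 1))⁻¹ * (D ^ (-z))⁻¹ := by
    rw [← rpow_natCast D 2, ← rpow_neg hD.le, ← rpow_neg hD.le, ← rpow_neg hD.le, ← rpow_neg hD.le,
      ← rpow_add hD, ← rpow_add hD, ← rpow_add hD]
    congr 1; push_cast; ring
  rw [f1, f2]
  simp only [div_eq_mul_inv]
  ring

lemma euler_transform {k y z w : ℝ} (hk : 0 < k) (hy : 0 < y) (hz : 0 < z) (hzu : z < y + k)
    (h0 : 0 < w) (h1 : w < 1) :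
    F21 y z (y + k) w = (1 - w) ^ (k - z) * F21 k (y + k - z) (y + k) w := by
  have hw : 0 < 1 - w := by linarith
  have A := euler_int hk hy hz hzu.le h0 h1
  have B := euler_int (z := y + k - z) hy hk (by linarith) (by linarith) h0 h1
  rw [euler_cov h0 h1, B, ← ENNReal.ofReal_mul (by positivity), add_comm k y] at A
  have hu : 0 < y + k := by positivity
  have hGk := Gamma_pos_of_pos hk
  have hGy := Gamma_pos_of_pos hy
  have hGu := Gamma_pos_of_pos hu
  have n1 := F21_nonneg (w := w) hy hz hzu.le h0.le
  have n2 := F21_nonneg (w := w) (u := y + k) hk (y := y + k - z) (by linarith) (by linarith) h0.le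
  rw [ENNReal.ofReal_eq_ofReal_iff (by positivity) (by positivity)] at A
  have hc : Gamma k * Gamma y / Gamma (y + k) ≠ 0 := by positivity
  apply mul_left_cancel₀ hc
  rw [← A]; ring

lemma lint_F21 {p q x y u : ℝ} (hp : 0 < p) (hq : 0 < q) (hx : 0 < x) (hy : 0 < y)
    (hyu : y ≤ u) :
    ∫⁻ t in Set.Ioo (0 : ℝ) 1,
        ENNReal.ofReal (t ^ (p - 1) * (1 - t) ^ (q - 1) * F21 x y u (1 - t)) =
      ENNReal.ofReal (Gamma p * Gamma q) * ∑' n : ℕ, ENNReal.ofReal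
        (poch x n * poch y n * poch q n / (poch u n * n.factorial * Gamma (p + q + n))) := by
  have hGp := Gamma_pos_of_pos hp
  have hGq := Gamma_pos_of_pos hq
  rw [lint_series hp hq _ (coef_nonneg hx hy (hy.trans_le hyu)) _
    (fun t ht => F21_hasSum hx hy hyu (by linarith [ht.2]) (by linarith [ht.1])),
    ← ENNReal.tsum_mul_left]
  congr 1; ext n
  rw [← ENNReal.ofReal_mul (by positivity)]
  congr 1
  simp only [div_eq_mul_inv, mul_inv]
  ring

lemma F21_measurable (x y u : ℝ) : Measurable (F21 x y u) := by
  unfold F21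
  fun_prop

lemma int_eq {p q x y u : ℝ} (hx : 0 < x) (hy : 0 < y) (hyu : y ≤ u) :
    ∫ t in Set.Ioo (0 : ℝ) 1, t ^ (p - 1) * (1 - t) ^ (q - 1) * F21 x y u (1 - t) =
    (∫⁻ t in Set.Ioo (0 : ℝ) 1,
        ENNReal.ofReal (t ^ (p - 1) * (1 - t) ^ (q - 1) * F21 x y u (1 - t))).toReal := by
  have := F21_measurable x y u
  refine integral_eq_lintegral_of_nonneg_ae ?_ (Measurable.aestronglyMeasurable (by fun_prop))
  refine (ae_restrict_iff' measurableSet_Ioo).2 (ae_of_all _ fun t ht => ?_)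
  have ht0 : 0 < t := ht.1
  have ht1 : 0 < 1 - t := by linarith [ht.2]
  have := F21_nonneg (w := 1 - t) hx hy hyu ht1.le
  simp only [Pi.zero_apply]
  positivity

/-- The integral identity arising from Thomae's first relation. -/
theorem thomae_integral_identity (a b c d e : ℝ) (ha : 0 < a) (hb : 0 < b) (hc : 0 < c)
    (hea : a < e) (hda : a < d) (hs : 0 < d + e - a - b - c) (hmm : max b c < min d e) :
    (∫ t in Set.Ioo (0 : ℝ) 1,
        t ^ (b - 1) * (1 - t) ^ (d + e - a - b - c - 1) *
          F21 (e - c) (d - c) (d + e - b - c) (1 - t)) =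
      Gamma b * Gamma c * Gamma (d + e - a - b - c) / (Gamma a * Gamma (d - a) * Gamma (e - a)) *
        ∫ t in Set.Ioo (0 : ℝ) 1,
          t ^ (e - a - 1) * (1 - t) ^ (a - 1) *
            F21 (e - c) (e - b) (d + e - b - c) (1 - t) := by
  obtain ⟨⟨hbd, hcd⟩, hbe, hce⟩ : (b < d ∧ c < d) ∧ b < e ∧ c < e := by
    simpa [lt_min_iff, max_lt_iff] using hmm
  have p1 : 0 < e - c := by linarith
  have p2 : 0 < d - c := by linarith
  have p3 : 0 < e - b := by linarith
  have p4 : 0 < d - a := by linarith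
  have p5 : 0 < e - a := by linarith
  rw [int_eq p1 p2 (by linarith), int_eq p1 p3 (by linarith)]
  have G1 := Gamma_pos_of_pos p1
  have G4 := Gamma_pos_of_pos p4
  have G5 := Gamma_pos_of_pos p5
  have Ga := Gamma_pos_of_pos ha
  have Gb := Gamma_pos_of_pos hb
  have Gc := Gamma_pos_of_pos hc
  have Gs := Gamma_pos_of_pos hs
  rw [lint_F21 hb hs p1 p2 (by linarith), lint_F21 p5 ha p1 p3 (by linarith)]
  have A := lint_F21 (u := d + e - b - c) p4 p1 p2 hs (by linarith)
  have B := lint_F21 (u := d + e - b - c) hc p1 p3 ha (by linarith)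
  have AB : ∫⁻ t in Set.Ioo (0 : ℝ) 1, ENNReal.ofReal (t ^ (d - a - 1) * (1 - t) ^ (e - c - 1) *
        F21 (d - c) (d + e - a - b - c) (d + e - b - c) (1 - t)) =
      ∫⁻ t in Set.Ioo (0 : ℝ) 1, ENNReal.ofReal (t ^ (c - 1) * (1 - t) ^ (e - c - 1) *
        F21 (e - b) a (d + e - b - c) (1 - t)) := by
    refine setLIntegral_congr_fun measurableSet_Ioo fun t ht => ?_
    obtain ⟨ht0, ht1⟩ := ht
    have E := euler_transform (w := 1 - t) p3 p2 hs (by linarith) (by linarith) (by linarith)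
    rw [show d - c + (e - b) = d + e - b - c by ring,
      show d + e - b - c - (d + e - a - b - c) = a by ring,
      show e - b - (d + e - a - b - c) = a + c - d by ring, sub_sub_cancel] at E
    rw [E, show c - 1 = (d - a - 1) + (a + c - d) by ring, rpow_add ht0]
    congr 1; ring
  rw [A, B] at AB
  have T1 : (∑' n : ℕ, ENNReal.ofReal (poch (e - c) n * poch (d - c) n *
      poch (d + e - a - b - c) n / (poch (d + e - b - c) n * n.factorial *
        Gamma (b + (d + e - a - b - c) + n)))) =
      ∑' n : ℕ, ENNReal.ofReal (poch (d - c) n * poch (d + e - a - b - c) n * poch (e - c) n /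
        (poch (d + e - b - c) n * n.factorial * Gamma (d - a + (e - c) + n))) := by
    congr 1; ext n; congr 1
    rw [show b + (d + e - a - b - c) + n = d - a + (e - c) + n by ring]; ring
  have T2 : (∑' n : ℕ, ENNReal.ofReal (poch (e - c) n * poch (e - b) n *
      poch a n / (poch (d + e - b - c) n * n.factorial * Gamma (e - a + a + n)))) =
      ∑' n : ℕ, ENNReal.ofReal (poch (e - b) n * poch a n * poch (e - c) n /
        (poch (d + e - b - c) n * n.factorial * Gamma (c + (e - c) + n))) := by
    congr 1; ext n; congr 1
    rw [show e - a + a + n = c + (e - c) + n by ring]; ring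
  rw [T1, T2]
  have AB' := congrArg ENNReal.toReal AB
  simp only [ENNReal.toReal_mul] at AB' ⊢
  rw [ENNReal.toReal_ofReal (by positivity), ENNReal.toReal_ofReal (by positivity)] at AB' ⊢
  generalize ENNReal.toReal (∑' n : ℕ, _) = X at AB' ⊢
  generalize ENNReal.toReal (∑' n : ℕ, _) = Y at AB' ⊢
  have hX : X = Gamma c * Y / Gamma (d - a) := by
    field_simp
    apply mul_left_cancel₀ G1.ne'
    linear_combination AB'
  rw [hX]
  field_simp
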